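/- Every real A ∈ KT(Δ⁰₂) is infinitely often K-trivial. -/

import Mathlib

/-! Common framework: prefix-free Kolmogorov complexity via a universal
prefix-free oracle machine, Δ⁰₂ functions and orders, Turing and wtt
reducibility, Ω, and the uniform measure on Cantor space. -/

/-- Finite binary strings, `2^{<ω}`. -/
abbrev BinStr := List Bool

/-- Reals, i.e. infinite binary sequences `2^ω`. -/
abbrev Seq2 := ℕ → Bool

/-- The initial segment `A↾n` of a real `A ∈ 2^ω`. -/
def restrict (A : Seq2) (n : ℕ) : BinStr := (List.range n).map A

/-- A prefix-free oracle machine, presented as a computable enumeration of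
axioms `(τ, p, y)`, meaning: on any oracle extending `τ`, the machine halts on
program `p` with output `y`.  Consistency says that for compatible oracle
strings the halting programs form a prefix-free set and outputs are unique. -/
structure PrefixOracleMachine where
  axioms : ℕ → Option (BinStr × BinStr × BinStr)
  axioms_computable : Computable axioms
  consistent : ∀ s t τ₁ p₁ y₁ τ₂ p₂ y₂,
    axioms s = some (τ₁, p₁, y₁) → axioms t = some (τ₂, p₂, y₂) →
    (τ₁ <+: τ₂ ∨ τ₂ <+: τ₁) → p₁ <+: p₂ → p₁ = p₂ ∧ y₁ = y₂

/-- `M.Computes A p y` : with oracle `A`, machine `M` halts on program `p` with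
output `y`. -/
def PrefixOracleMachine.Computes (M : PrefixOracleMachine) (A : Seq2) (p y : BinStr) : Prop :=
  ∃ s τ, M.axioms s = some (τ, p, y) ∧ ∃ n, τ = restrict A n

/-- A universal prefix-free oracle machine: it describes every string (relative
to every oracle), and it simulates every prefix-free oracle machine up to an
additive constant in the length of programs. -/
structure UniversalPrefixMachine extends PrefixOracleMachine where
  total : ∀ (A : Seq2) (y : BinStr), ∃ p, toPrefixOracleMachine.Computes A p y
  universal : ∀ M : PrefixOracleMachine, ∃ c : ℕ, ∀ (A : Seq2) (p y : BinStr),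
    M.Computes A p y →
      ∃ q, toPrefixOracleMachine.Computes A q y ∧ q.length ≤ p.length + c

/-- `K^A(y)` : prefix-free Kolmogorov complexity of `y` relative to oracle `A`. -/
noncomputable def KOr (U : UniversalPrefixMachine) (A : Seq2) (y : BinStr) : ℕ :=
  sInf {n | ∃ p : BinStr, p.length = n ∧ U.toPrefixOracleMachine.Computes A p y}

/-- The all-zeros (recursive) oracle. -/
def zeroSeq : Seq2 := fun _ => false

/-- `K(y)` : (unrelativized) prefix-free Kolmogorov complexity. -/
noncomputable def Kc (U : UniversalPrefixMachine) (y : BinStr) : ℕ := KOr U zeroSeq y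

/-- `K(n)` : the complexity of the string of `n` zeros. -/
noncomputable def KcNat (U : UniversalPrefixMachine) (n : ℕ) : ℕ :=
  Kc U (List.replicate n false)

/-- `A ∈ KT(g)` : `A` is K-trivial up to `g`. -/
def KT (U : UniversalPrefixMachine) (g : ℕ → ℕ) (A : Seq2) : Prop :=
  ∃ c : ℕ, ∀ n : ℕ, Kc U (restrict A n) ≤ KcNat U n + g n + c

/-- `A ∈ LK(f)` : `A` is low for K up to `f`. -/
def LK (U : UniversalPrefixMachine) (f : BinStr → ℕ) (A : Seq2) : Prop :=
  ∃ c : ℕ, ∀ σ : BinStr, Kc U σ ≤ KOr U A σ + f σ + c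

/-- The position of a string in the length-lexicographic ordering of `2^{<ω}`. -/
def strNum (σ : BinStr) : ℕ := σ.foldl (fun n b => 2 * n + (if b then 2 else 1)) 0

/-- A function `ℕ → ℕ` is Δ⁰₂ iff it has a recursive approximation. -/
def Delta02Fun (g : ℕ → ℕ) : Prop :=
  ∃ G : ℕ → ℕ → ℕ, Computable₂ G ∧ ∀ x, ∃ t, ∀ s ≥ t, G s x = g x

/-- A function `2^{<ω} → ℕ` is Δ⁰₂ iff it has a recursive approximation. -/
def Delta02StrFun (f : BinStr → ℕ) : Prop :=
  ∃ F : ℕ → BinStr → ℕ, Computable₂ F ∧ ∀ σ, ∃ t, ∀ s ≥ t, F s σ = f σ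

/-- A real is Δ⁰₂ iff it has a recursive approximation. -/
def Delta02Seq (A : Seq2) : Prop :=
  ∃ F : ℕ → ℕ → Bool, Computable₂ F ∧ ∀ x, ∃ t, ∀ s ≥ t, F s x = A x

/-- An order: an unbounded nondecreasing function `ℕ → ℕ`. -/
def IsOrder (g : ℕ → ℕ) : Prop := Monotone g ∧ ∀ b : ℕ, ∃ m, b < g m

/-- An order on strings: unbounded and nondecreasing with respect to the
length-lexicographic ordering of `2^{<ω}`. -/
def IsStrOrder (f : BinStr → ℕ) : Prop :=
  (∀ σ τ : BinStr, strNum σ ≤ strNum τ → f σ ≤ f τ) ∧ ∀ b : ℕ, ∃ σ, b < f σ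

/-- `A ∈ KT(Δ⁰₂)` : `A` is K-trivial up to every Δ⁰₂ order. -/
def KTDelta (U : UniversalPrefixMachine) (A : Seq2) : Prop :=
  ∀ g : ℕ → ℕ, Delta02Fun g → IsOrder g → KT U g A

/-- `A ∈ LK(Δ⁰₂)` : `A` is low for K up to every Δ⁰₂ order. -/
def LKDelta (U : UniversalPrefixMachine) (A : Seq2) : Prop :=
  ∀ f : BinStr → ℕ, Delta02StrFun f → IsStrOrder f → LK U f A

/-- A Δ⁰₂ function is finite-to-one approximable if it has a recursive
approximation `F` such that for every `n`, for all but finitely many `m`,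
`F s m > n` for all stages `s`. -/
def FinToOneApprox (f : ℕ → ℕ) : Prop :=
  ∃ F : ℕ → ℕ → ℕ, Computable₂ F ∧ (∀ x, ∃ t, ∀ s ≥ t, F s x = f x) ∧
    ∀ n : ℕ, {m : ℕ | ∃ s, F s m ≤ n}.Finite

/-- A Turing functional, presented as a computable enumeration of axioms
`(τ, n, b)`, meaning: on any oracle extending `τ`, the output bit `n` is `b`. -/
structure TuringFunctional where
  axioms : ℕ → Option (BinStr × ℕ × Bool)
  axioms_computable : Computable axioms
  consistent : ∀ s t τ₁ n₁ b₁ τ₂ n₂ b₂,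
    axioms s = some (τ₁, n₁, b₁) → axioms t = some (τ₂, n₂, b₂) →
    (τ₁ <+: τ₂ ∨ τ₂ <+: τ₁) → n₁ = n₂ → b₁ = b₂

/-- `Φ.Computes B A` : `Φ^B = A`. -/
def TuringFunctional.Computes (Φ : TuringFunctional) (B A : Seq2) : Prop :=
  ∀ n : ℕ, ∃ s k, Φ.axioms s = some (restrict B k, n, A n)

/-- Turing reducibility `A ≤_T B`. -/
def TuringLE (A B : Seq2) : Prop := ∃ Φ : TuringFunctional, Φ.Computes B A

/-- Weak truth-table reducibility `A ≤_wtt B` : a Turing reduction whose use is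
bounded by a recursive function. -/
def WttLE (A B : Seq2) : Prop :=
  ∃ (Φ : TuringFunctional) (u : ℕ → ℕ), Computable u ∧
    ∀ n : ℕ, ∃ s k, k ≤ u n ∧ Φ.axioms s = some (restrict B k, n, A n)

/-- The effective join `A ⊕ B`. -/
def join (A B : Seq2) : Seq2 := fun n => if n % 2 = 0 then A (n / 2) else B (n / 2)

/-- `A` is Martin-Löf random: `K(A↾n) ≥ n - c` for all `n`. -/
def MLRandom (U : UniversalPrefixMachine) (A : Seq2) : Prop :=
  ∃ c : ℕ, ∀ n : ℕ, n ≤ Kc U (restrict A n) + c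

/-- `A` is infinitely often K-trivial. -/
def InfOftenKTrivial (U : UniversalPrefixMachine) (A : Seq2) : Prop :=
  ∃ c : ℕ, {n : ℕ | Kc U (restrict A n) ≤ KcNat U n + c}.Infinite

/-- K-reducibility `B ≤_K A`. -/
def KLE (U : UniversalPrefixMachine) (B A : Seq2) : Prop :=
  ∃ c : ℕ, ∀ n : ℕ, Kc U (restrict B n) ≤ Kc U (restrict A n) + c

/-- LK-reducibility `A ≤_LK B`. -/
def LKLE (U : UniversalPrefixMachine) (A B : Seq2) : Prop :=
  ∃ c : ℕ, ∀ σ : BinStr, KOr U B σ ≤ KOr U A σ + c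

/-- `A` is weakly low for K: `K(σ) ≤ K^A(σ) + c` for infinitely many strings σ. -/
def WeaklyLowForK (U : UniversalPrefixMachine) (A : Seq2) : Prop :=
  ∃ c : ℕ, {σ : BinStr | Kc U σ ≤ KOr U A σ + c}.Infinite

/-- Chaitin's Ω : the measure of the domain of the universal machine. -/
noncomputable def Omega (U : UniversalPrefixMachine) : ℝ :=
  ∑' p : {p : BinStr // ∃ y, U.toPrefixOracleMachine.Computes zeroSeq p y},
    ((2 : ℝ) ^ (p : BinStr).length)⁻¹

/-- The `n`-th binary digit of a real number `x`. -/
noncomputable def realBit (x : ℝ) (n : ℕ) : Bool :=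
  decide (⌊x * 2 ^ (n + 1)⌋ % 2 = 1)

/-- `Ω↾n` : the length-`n` initial segment of the binary expansion of Ω. -/
noncomputable def omegaStr (U : UniversalPrefixMachine) (n : ℕ) : BinStr :=
  (List.range n).map (realBit (Omega U))

/-- `A` is low for Ω. -/
def LowForOmega (U : UniversalPrefixMachine) (A : Seq2) : Prop :=
  ∀ c : ℕ, ∃ n : ℕ, KOr U A (omegaStr U n) + c < n

/-- The uniform (coin-flipping) measure on `2^ω`, obtained as the image of
Lebesgue measure on `[0,1]` under the binary-expansion map. -/
noncomputable def cantorMeasure : MeasureTheory.Measure Seq2 :=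
  MeasureTheory.Measure.map (fun x : ℝ => fun n : ℕ => realBit x n)
    (MeasureTheory.volume.restrict (Set.Icc (0 : ℝ) 1))

/-- Some program of `U` witnesses the complexity of `y`. -/
theorem exists_program_length_eq_Kc (U : UniversalPrefixMachine) (y : BinStr) :
    ∃ p : BinStr, p.length = Kc U y ∧ U.toPrefixOracleMachine.Computes zeroSeq p y := by
  obtain ⟨p, hp⟩ := U.total zeroSeq y
  exact Nat.sInf_mem (s := {n | ∃ p : BinStr, p.length = n ∧
    U.toPrefixOracleMachine.Computes zeroSeq p y}) ⟨_, p, rfl, hp⟩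

theorem Kc_le_length (U : UniversalPrefixMachine) {p y : BinStr}
    (h : U.toPrefixOracleMachine.Computes zeroSeq p y) : Kc U y ≤ p.length :=
  Nat.sInf_le ⟨p, rfl, h⟩

/-- Post-composition of a prefix-free oracle machine with a computable function. -/
def PrefixOracleMachine.postcomp (M : PrefixOracleMachine) (φ : BinStr → BinStr)
    (hφ : Computable φ) : PrefixOracleMachine where
  axioms s := (M.axioms s).map fun t => (t.1, t.2.1, φ t.2.2)
  axioms_computable := by
    refine Computable.option_map M.axioms_computable ?_
    have h : Computable fun x : ℕ × BinStr × BinStr × BinStr => x.2 := Computable.snd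
    exact (Computable.pair (Computable.fst.comp h)
      (Computable.pair (Computable.fst.comp (Computable.snd.comp h))
        (hφ.comp (Computable.snd.comp (Computable.snd.comp h))))).to₂
  consistent := by
    intro s t τ₁ p₁ y₁ τ₂ p₂ y₂ h₁ h₂ hτ hp
    simp only [Option.map_eq_some_iff, Prod.mk.injEq, Prod.exists] at h₁ h₂
    obtain ⟨_, _, z₁, e₁, rfl, rfl, rfl⟩ := h₁
    obtain ⟨_, _, z₂, e₂, rfl, rfl, rfl⟩ := h₂
    obtain ⟨h, rfl⟩ := M.consistent _ _ _ _ _ _ _ _ e₁ e₂ hτ hp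
    exact ⟨h, rfl⟩

/-- Computable functions do not increase complexity, up to a constant. -/
theorem exists_Kc_apply_le (U : UniversalPrefixMachine) {φ : BinStr → BinStr}
    (hφ : Computable φ) : ∃ c, ∀ y, Kc U (φ y) ≤ Kc U y + c := by
  obtain ⟨c, hc⟩ := U.universal (U.toPrefixOracleMachine.postcomp φ hφ)
  refine ⟨c, fun y => ?_⟩
  obtain ⟨p, hp, s, τ, hs, hτ⟩ := exists_program_length_eq_Kc U y
  obtain ⟨q, hq, hl⟩ := hc zeroSeq p (φ y)
    ⟨s, τ, by simp [PrefixOracleMachine.postcomp, hs], hτ⟩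
  exact (Kc_le_length U hq).trans (by omega)

theorem eq_of_replicate_append_isPrefix {s t : ℕ}
    (h : List.replicate s true ++ [false] <+: List.replicate t true ++ [false]) : s = t := by
  have hle : s ≤ t := by simpa using h.length_le
  rcases hle.eq_or_lt with rfl | hlt
  · rfl
  · have := h.getElem (i := s) (by simp)
    simp [hlt] at this

theorem primrec_replicate {α : Type*} [Primcodable α] (a : α) :
    Primrec fun n : ℕ => List.replicate n a := by
  refine (Primrec.list_map Primrec.list_range (Primrec.const a).to₂).of_eq fun n => ?_
  simp [List.map_const']

/-- The machine that on program `1ˢ0` outputs `φ s`, for every oracle. -/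
def PrefixOracleMachine.ofUnary (φ : ℕ → BinStr) (hφ : Computable φ) : PrefixOracleMachine where
  axioms s := some ([], List.replicate s true ++ [false], φ s)
  axioms_computable :=
    Computable.option_some.comp (Computable.pair (Computable.const [])
      (Computable.pair
        (Primrec.list_append.comp (primrec_replicate true) (Primrec.const [false])).to_comp hφ))
  consistent := by
    intro s t τ₁ p₁ y₁ τ₂ p₂ y₂ h₁ h₂ _ hp
    simp only [Option.some.injEq, Prod.mk.injEq] at h₁ h₂
    obtain ⟨-, rfl, rfl⟩ := h₁
    obtain ⟨-, rfl, rfl⟩ := h₂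
    obtain rfl := eq_of_replicate_append_isPrefix hp
    exact ⟨rfl, rfl⟩

theorem exists_Kc_le_add (U : UniversalPrefixMachine) {φ : ℕ → BinStr} (hφ : Computable φ) :
    ∃ c, ∀ i, Kc U (φ i) ≤ i + c := by
  obtain ⟨c, hc⟩ := U.universal (PrefixOracleMachine.ofUnary φ hφ)
  refine ⟨c + 1, fun i => ?_⟩
  obtain ⟨q, hq, hl⟩ := hc zeroSeq (List.replicate i true ++ [false]) (φ i)
    ⟨i, [], rfl, 0, rfl⟩
  have := Kc_le_length U hq
  simp at hl
  omega

/-- Binary strings of length at most `n` have code at most that of `n` ones. -/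
theorem encode_le_encode_replicate (σ : BinStr) :
    ∀ n, σ.length ≤ n → Encodable.encode σ ≤ Encodable.encode (List.replicate n true) := by
  induction σ with
  | nil => simp
  | cons a l ih =>
    rintro (_ | n) h
    · simp at h
    · have hb : Encodable.encode a ≤ Encodable.encode true := by cases a <;> decide
      simp only [List.replicate_succ, Encodable.encode_list_cons]
      have hl : Encodable.encode l ≤ Encodable.encode (List.replicate n true) :=
        ih n (by simpa using h)
      have h₁ : StrictMono fun x => Nat.pair x (Encodable.encode l) :=
        fun _ _ hx => Nat.pair_lt_pair_left _ hx
      have h₂ : StrictMono (Nat.pair (Encodable.encode true)) :=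
        fun _ _ hx => Nat.pair_lt_pair_right _ hx
      exact Nat.succ_le_succ ((h₁.monotone hb).trans (h₂.monotone hl))

/-- A fast growing sequence: every string of length at most `tower i` has code less than
`tower (i + 1)`. -/
def tower (i : ℕ) : ℕ :=
  (fun m => Encodable.encode (List.replicate m true) + 1)^[i] 0

theorem tower_succ (i : ℕ) :
    tower (i + 1) = Encodable.encode (List.replicate (tower i) true) + 1 :=
  Function.iterate_succ_apply' _ _ _

theorem tower_strictMono : StrictMono tower := by
  refine strictMono_nat_of_lt_succ fun i => ?_
  have := Encodable.length_le_encode (List.replicate (tower i) true)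
  rw [List.length_replicate] at this
  rw [tower_succ]
  omega

theorem encode_lt_tower_succ {σ : BinStr} {i : ℕ} (h : σ.length ≤ tower i) :
    Encodable.encode σ < tower (i + 1) := by
  rw [tower_succ]
  exact Nat.lt_succ_of_le (encode_le_encode_replicate σ _ h)

theorem primrec_tower : Primrec tower :=
  Primrec.nat_iterate Primrec.id (Primrec.const 0)
    (Primrec.succ.comp (Primrec.encode.comp ((primrec_replicate true).comp Primrec.snd))).to₂

/-- The slow growing inverse of `tower`. -/
def towerInv (n : ℕ) : ℕ := Nat.findGreatest (fun i => tower i ≤ n) n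

theorem towerInv_tower (i : ℕ) : towerInv (tower i) = i := by
  refine le_antisymm ?_ (Nat.le_findGreatest tower_strictMono.le_apply le_rfl)
  refine tower_strictMono.le_iff_le.1 ?_
  exact Nat.findGreatest_spec (P := fun j => tower j ≤ tower i) tower_strictMono.le_apply le_rfl

theorem primrec_towerInv : Primrec towerInv :=
  Primrec.nat_findGreatest Primrec.id
    (Primrec.nat_le.comp (primrec_tower.comp Primrec.snd) Primrec.fst)

theorem isOrder_towerInv : IsOrder towerInv := by
  refine ⟨fun m n h => Nat.findGreatest_mono (fun i hi => le_trans hi h) h, fun b => ?_⟩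
  exact ⟨tower (b + 1), by rw [towerInv_tower]; omega⟩

theorem delta02Fun_of_computable {g : ℕ → ℕ} (hg : Computable g) : Delta02Fun g :=
  ⟨fun _ => g, (hg.comp Computable.snd).to₂, fun _ => ⟨0, fun _ _ => rfl⟩⟩

theorem length_restrict (A : Seq2) (n : ℕ) : (restrict A n).length = n := by
  simp [restrict]

theorem take_restrict (A : Seq2) {m n : ℕ} (h : m ≤ n) :
    (restrict A n).take m = restrict A m := by
  simp [restrict, ← List.map_take, List.take_range, h]

/-- The sequence `n₀`, `code (A↾n₀)`, `code (A↾code (A↾n₀))`, … -/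
def codeSeq (A : Seq2) (n₀ : ℕ) : ℕ → ℕ
  | 0 => n₀
  | j + 1 => Encodable.encode (restrict A (codeSeq A n₀ j))

theorem le_codeSeq (A : Seq2) (n₀ j : ℕ) : n₀ ≤ codeSeq A n₀ j := by
  induction j with
  | zero => exact le_rfl
  | succ j ih =>
    refine ih.trans ?_
    simpa [length_restrict, codeSeq] using Encodable.length_le_encode (restrict A (codeSeq A n₀ j))

theorem codeSeq_le_tower (A : Seq2) (n₀ j : ℕ) : codeSeq A n₀ j ≤ tower (n₀ + j) := by
  induction j with
  | zero => exact tower_strictMono.le_apply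
  | succ j ih => exact (encode_lt_tower_succ (by rwa [length_restrict])).le

/-- Recovers `A↾codeSeq A n₀ j` from `A↾tower (n₀ + j)`. -/
def codeSeqPrefix (n₀ : ℕ) (ρ : BinStr) : BinStr :=
  (fun σ : BinStr => ρ.take (Encodable.encode σ))^[towerInv ρ.length - n₀] (ρ.take n₀)

theorem codeSeqPrefix_restrict (A : Seq2) (n₀ j : ℕ) :
    codeSeqPrefix n₀ (restrict A (tower (n₀ + j))) = restrict A (codeSeq A n₀ j) := by
  have key : ∀ i ≤ j, (fun σ : BinStr =>
      (restrict A (tower (n₀ + j))).take (Encodable.encode σ))^[i]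
        ((restrict A (tower (n₀ + j))).take n₀) = restrict A (codeSeq A n₀ i) := by
    have hle : ∀ i ≤ j, codeSeq A n₀ i ≤ tower (n₀ + j) := fun i hi =>
      (codeSeq_le_tower A n₀ i).trans (tower_strictMono.monotone (by omega))
    intro i
    induction i with
    | zero => exact fun hi => take_restrict A (hle 0 hi)
    | succ i ih =>
      intro hi
      rw [Function.iterate_succ_apply', ih (by omega)]
      exact take_restrict A (hle (i + 1) hi)
  rw [codeSeqPrefix, length_restrict, towerInv_tower, Nat.add_sub_cancel_left]
  exact key j le_rfl

theorem primrec_codeSeqPrefix (n₀ : ℕ) : Primrec (codeSeqPrefix n₀) :=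
  Primrec.nat_iterate
    (Primrec.nat_sub.comp (primrec_towerInv.comp Primrec.list_length) (Primrec.const n₀))
    (Primrec.list_take.comp (Primrec.const n₀) Primrec.id)
    (Primrec.list_take.comp (Primrec.encode.comp Primrec.snd) Primrec.fst).to₂

/-- The complexity of a string is at most that of its code, up to a constant. -/
theorem exists_Kc_le_KcNat_encode (U : UniversalPrefixMachine) :
    ∃ d, ∀ σ : BinStr, Kc U σ ≤ KcNat U (Encodable.encode σ) + d := by
  have h : Primrec fun ρ : BinStr => (Encodable.decode (α := BinStr) ρ.length).getD [] :=
    Primrec.option_getD.comp (Primrec.decode.comp Primrec.list_length) (Primrec.const [])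
  obtain ⟨d, hd⟩ := exists_Kc_apply_le U h.to_comp
  refine ⟨d, fun σ => ?_⟩
  simpa [KcNat] using hd (List.replicate (Encodable.encode σ) false)

/-- every real in KT(Δ⁰₂) is infinitely often K-trivial. -/
theorem stmt14 (U : UniversalPrefixMachine) (A : Seq2) (h : KTDelta U A) :
    InfOftenKTrivial U A := by
  obtain ⟨d, hd⟩ := exists_Kc_le_KcNat_encode U
  refine ⟨d + 3, fun hfin => ?_⟩
  obtain ⟨b, hb⟩ := hfin.bddAbove
  have hgap : ∀ n ≥ b + 1, KcNat U n + (d + 3) < Kc U (restrict A n) := by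
    intro n hn
    by_contra hle
    have := hb (show n ∈ {n | _} from not_lt.1 hle)
    omega
  have hlower : ∀ j, 3 * j ≤ Kc U (restrict A (codeSeq A (b + 1) j)) := by
    intro j
    induction j with
    | zero => simp
    | succ j ih =>
      have h₁ := hgap _ (le_codeSeq A (b + 1) (j + 1))
      have h₂ := hd (restrict A (codeSeq A (b + 1) j))
      simp only [codeSeq] at h₁ ⊢
      omega
  obtain ⟨c₁, hc₁⟩ := exists_Kc_apply_le U (primrec_codeSeqPrefix (b + 1)).to_comp
  obtain ⟨c₂, hc₂⟩ := exists_Kc_le_add U ((primrec_replicate false).comp primrec_tower).to_comp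
  obtain ⟨c₃, hc₃⟩ :=
    h towerInv (delta02Fun_of_computable primrec_towerInv.to_comp) isOrder_towerInv
  have hupper : ∀ j, Kc U (restrict A (codeSeq A (b + 1) j)) ≤
      2 * j + (2 * (b + 1) + c₁ + c₂ + c₃) := by
    intro j
    have h₁ := hc₁ (restrict A (tower (b + 1 + j)))
    have h₂ := hc₂ (b + 1 + j)
    have h₃ := hc₃ (tower (b + 1 + j))
    rw [codeSeqPrefix_restrict] at h₁
    rw [towerInv_tower, KcNat] at h₃
    omega
  have h₁ := hlower (2 * (b + 1) + c₁ + c₂ + c₃ + 1)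
  have h₂ := hupper (2 * (b + 1) + c₁ + c₂ + c₃ + 1)
  omega
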